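/- arXiv:1801.05873 — 3 statements merged into one kernel-verified Lean document; each statement's English description precedes it below -/
import Mathlib

section
/- Let D be a real random variable with density p_D(d) = 2d/R² on the interval (0, R), and let X be an independent real Gaussian random variable with mean 0 and variance σ². Define the large-scale fading G = 10^{−(α + β·log₁₀(D) + X)/20}. Then the law of G is absolutely continuous with respect to Lebesgue measure on ℝ, with density p_G(g) = a·g^{−γ}·Q(g) for g > 0 (and 0 for g ≤ 0). -/
open MeasureTheory Set
open scoped ENNReal

noncomputable section

/-- `Q(g) = ∫_{b ln g + c}^∞ exp(-s²) ds`. -/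
def Qfun (b c g : ℝ) : ℝ := ∫ s in Set.Ioi (b * Real.log g + c), Real.exp (-s ^ 2)

/-- The distance at which the large-scale fading equals `g` when the shadowing equals `x`. -/
def fadingDist (α β x g : ℝ) : ℝ := Real.exp (-(Real.log 10 * (α + x)) / β) * g ^ (-(20 / β))

lemma fadingDist_eq_exp (α β x : ℝ) {g : ℝ} (hg : 0 < g) :
    fadingDist α β x g = Real.exp (-(Real.log 10 * (α + x)) / β - 20 / β * Real.log g) := by
  rw [fadingDist, Real.rpow_def_of_pos hg, ← Real.exp_add]
  congr 1
  ring

lemma fading_fadingDist (α x : ℝ) {β g : ℝ} (hβ : 0 < β) (hg : 0 < g) :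
    (10 : ℝ) ^ (-(α + β * Real.logb 10 (fadingDist α β x g) + x) / 20) = g := by
  have hL : 0 < Real.log 10 := Real.log_pos (by norm_num)
  rw [fadingDist_eq_exp α β x hg, Real.logb, Real.log_exp, Real.rpow_def_of_pos (by norm_num)]
  conv_rhs => rw [← Real.exp_log hg]
  congr 1
  field_simp
  ring

lemma fadingDist_fading (α x : ℝ) {β d : ℝ} (hβ : 0 < β) (hd : 0 < d) :
    fadingDist α β x ((10 : ℝ) ^ (-(α + β * Real.logb 10 d + x) / 20)) = d := by
  have hL : 0 < Real.log 10 := Real.log_pos (by norm_num)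
  rw [fadingDist_eq_exp α β x (by positivity), Real.log_rpow (by norm_num), Real.logb]
  conv_rhs => rw [← Real.exp_log hd]
  congr 1
  field_simp
  ring

lemma image_fadingDist_Ioi (α x : ℝ) {β : ℝ} (hβ : 0 < β) :
    fadingDist α β x '' Ioi 0 = Ioi 0 := by
  ext d
  constructor
  · rintro ⟨g, hg, rfl⟩
    rw [fadingDist_eq_exp α β x hg]
    exact Real.exp_pos _
  · intro hd
    exact ⟨_, Real.rpow_pos_of_pos (by norm_num) _, fadingDist_fading α x hβ hd⟩

/-- Change of variables from the distance to the fading, at fixed shadowing. -/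
lemma lintegral_Ioi_fadingDist (α x : ℝ) {β : ℝ} (hβ : 0 < β) (F : ℝ → ℝ≥0∞) :
    ∫⁻ d in Ioi 0, F d =
      ∫⁻ g in Ioi 0, ENNReal.ofReal (20 / β * (fadingDist α β x g / g)) *
        F (fadingDist α β x g) := by
  have hderiv : ∀ g ∈ Ioi (0 : ℝ), HasDerivWithinAt (fadingDist α β x)
      (-(20 / β * (fadingDist α β x g / g))) (Ioi 0) g := by
    intro g hg
    have hg' : g ≠ 0 := ne_of_gt hg
    have h := ((Real.hasDerivAt_rpow_const (p := -(20 / β)) (Or.inl hg')).const_mul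
      (Real.exp (-(Real.log 10 * (α + x)) / β))).hasDerivWithinAt (s := Ioi 0)
    refine h.congr_deriv ?_
    rw [Real.rpow_sub_one hg', fadingDist]
    ring
  have hinj : InjOn (fadingDist α β x) (Ioi 0) := by
    intro g hg g' hg' h
    rw [← fading_fadingDist α x hβ hg, h, fading_fadingDist α x hβ hg']
  rw [← image_fadingDist_Ioi α x hβ,
    lintegral_image_eq_lintegral_abs_deriv_mul measurableSet_Ioi hderiv hinj,
    image_fadingDist_Ioi α x hβ]
  refine setLIntegral_congr_fun measurableSet_Ioi fun g hg => ?_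
  have hpos : 0 < fadingDist α β x g := by
    rw [fadingDist_eq_exp α β x hg]
    exact Real.exp_pos _
  have hg : 0 < g := hg
  simp only [abs_neg]
  rw [abs_of_pos (by positivity)]

/-- Affine substitution in a Gaussian tail integral. -/
lemma lintegral_indicator_exp_neg_sq {C τ : ℝ} (hC : 0 ≤ C) (hτ : 0 < τ) (δ t : ℝ) :
    ∫⁻ x, ENNReal.ofReal
        (C / τ * (Ioi t).indicator (fun s => Real.exp (-s ^ 2)) (x / τ + δ)) =
      ENNReal.ofReal (C * ∫ s in Ioi t, Real.exp (-s ^ 2)) := by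
  have hint : Integrable ((Ioi t).indicator fun s : ℝ => Real.exp (-s ^ 2)) := by
    have h := integrable_exp_neg_mul_sq (b := 1) one_pos
    simp only [neg_mul, one_mul] at h
    exact h.indicator measurableSet_Ioi
  rw [← ofReal_integral_eq_lintegral_ofReal]
  · congr 1
    rw [integral_const_mul, Measure.integral_comp_div
      (fun y => (Ioi t).indicator (fun s : ℝ => Real.exp (-s ^ 2)) (y + δ)) τ,
      integral_add_right_eq_self, integral_indicator measurableSet_Ioi, abs_of_pos hτ,
      smul_eq_mul]
    field_simp
  · exact ((hint.comp_add_right δ).comp_div hτ.ne').const_mul _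
  · exact .of_forall fun x => mul_nonneg (by positivity)
      (indicator_nonneg (fun _ _ => (Real.exp_pos _).le) _)

/-- Averaging the conditional density of the fading over the shadowing. -/
lemma lintegral_gaussianPDF_mul_fading {R α β σ : ℝ} (hR : 0 < R) (hβ : 0 < β) (hσ : 0 < σ)
    {γ a b c : ℝ} (hγ : γ = 40 / β + 1)
    (ha : a = 40 / (R ^ 2 * β * Real.sqrt Real.pi) *
      Real.exp (2 * (Real.log 10) ^ 2 * σ ^ 2 / β ^ 2 - 2 * (Real.log 10) * α / β))
    (hb : b = -10 * Real.sqrt 2 / ((Real.log 10) * σ))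
    (hc : c = (-α - β * Real.logb 10 R) / (Real.sqrt 2 * σ) - 20 / (β * b))
    {g : ℝ} (hg : 0 < g) :
    ∫⁻ x, ProbabilityTheory.gaussianPDF 0 (Real.toNNReal (σ ^ 2)) x *
        (ENNReal.ofReal (20 / β * (fadingDist α β x g / g)) *
          ENNReal.ofReal (if fadingDist α β x g ∈ Ioo 0 R
            then 2 * fadingDist α β x g / R ^ 2 else 0)) =
      ENNReal.ofReal (a * g ^ (-γ) * Qfun b c g) := by
  have hL : 0 < Real.log 10 := Real.log_pos (by norm_num)
  have h2 : 0 < Real.sqrt 2 := by positivity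
  have h22 : Real.sqrt 2 ^ 2 = 2 := Real.sq_sqrt (by norm_num)
  have hpi : 0 < Real.sqrt Real.pi := Real.sqrt_pos.2 Real.pi_pos
  have hδ : -(20 / (β * b)) = Real.sqrt 2 * Real.log 10 * σ / β := by
    rw [hb]
    field_simp
    rw [h22]
    norm_num
  have hτ : 0 < Real.sqrt 2 * σ := by positivity
  have ha0 : 0 ≤ a := by rw [ha]; positivity
  rw [Qfun, ← lintegral_indicator_exp_neg_sq (by positivity) hτ
    (Real.sqrt 2 * Real.log 10 * σ / β)]
  refine lintegral_congr fun x => ?_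
  have hd : 0 < fadingDist α β x g := by
    rw [fadingDist_eq_exp α β x hg]
    exact Real.exp_pos _
  have hiff : x / (Real.sqrt 2 * σ) + Real.sqrt 2 * Real.log 10 * σ / β ∈
      Ioi (b * Real.log g + c) ↔ fadingDist α β x g ∈ Ioo 0 R := by
    have hlt : fadingDist α β x g < R ↔
        -(Real.log 10 * (α + x)) / β - 20 / β * Real.log g < Real.log R := by
      rw [fadingDist_eq_exp α β x hg, Real.lt_log_iff_exp_lt hR]
    have hdiff : x / (Real.sqrt 2 * σ) + Real.sqrt 2 * Real.log 10 * σ / β -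
        (b * Real.log g + c) = β / (Real.log 10 * (Real.sqrt 2 * σ)) *
        (Real.log R - (-(Real.log 10 * (α + x)) / β - 20 / β * Real.log g)) := by
      rw [hc, sub_eq_add_neg _ (20 / (β * b)), hδ, hb, Real.logb]
      field_simp
      rw [h22]
      ring
    have hk : 0 < β / (Real.log 10 * (Real.sqrt 2 * σ)) := by positivity
    rw [mem_Ioo, and_iff_right hd, hlt, mem_Ioi, ← sub_pos, hdiff, mul_pos_iff_of_pos_left hk,
      sub_pos]
  rw [ProbabilityTheory.gaussianPDF, ← ENNReal.ofReal_mul (by positivity),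
    ← ENNReal.ofReal_mul (ProbabilityTheory.gaussianPDFReal_nonneg _ _ _)]
  congr 1
  by_cases hmem : fadingDist α β x g ∈ Ioo 0 R
  · rw [if_pos hmem, indicator_of_mem (hiff.2 hmem), ProbabilityTheory.gaussianPDFReal,
      Real.coe_toNNReal _ (by positivity), ha, hγ, Real.rpow_def_of_pos hg,
      fadingDist_eq_exp α β x hg]
    have hsqrt : Real.sqrt (2 * Real.pi * σ ^ 2) = Real.sqrt 2 * Real.sqrt Real.pi * σ := by
      rw [Real.sqrt_mul (by positivity), Real.sqrt_mul (by positivity), Real.sqrt_sq hσ.le]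
    rw [hsqrt]
    set E := Real.exp (-(Real.log 10 * (α + x)) / β - 20 / β * Real.log g) with hE
    have hexp : Real.exp (-(x - 0) ^ 2 / (2 * σ ^ 2)) * E ^ 2 / g =
        Real.exp (2 * Real.log 10 ^ 2 * σ ^ 2 / β ^ 2 - 2 * Real.log 10 * α / β) *
          Real.exp (Real.log g * -(40 / β + 1)) *
          Real.exp (-(x / (Real.sqrt 2 * σ) + Real.sqrt 2 * Real.log 10 * σ / β) ^ 2) := by
      conv_lhs => rw [← Real.exp_log hg]
      rw [hE, ← Real.exp_nat_mul, ← Real.exp_add, ← Real.exp_sub, ← Real.exp_add, ← Real.exp_add]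
      congr 1
      have h24 : (x / (Real.sqrt 2 * σ) + Real.sqrt 2 * Real.log 10 * σ / β) ^ 2 =
          x ^ 2 / (2 * σ ^ 2) + 2 * x * Real.log 10 / β +
            2 * Real.log 10 ^ 2 * σ ^ 2 / β ^ 2 := by
        rw [add_sq, div_pow, div_pow, mul_pow, mul_pow, mul_pow, h22]
        field_simp
      rw [h24]
      push_cast
      field_simp
      ring
    calc _ = 40 / (R ^ 2 * β * Real.sqrt Real.pi) / (Real.sqrt 2 * σ) *
          (Real.exp (-(x - 0) ^ 2 / (2 * σ ^ 2)) * E ^ 2 / g) := by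
          field_simp
          ring
      _ = _ := by
          rw [hexp]
          ring
  · rw [if_neg hmem, indicator_of_notMem (mt hiff.1 hmem)]
    ring

/-- the large-scale fading `G = 10^{-(α + β log₁₀ D + X)/20}` has density
`p_G(g) = a g^{-γ} Q(g)` on `(0,∞)`. -/
theorem stmt0
    {Ω : Type*} [MeasureSpace Ω] [IsProbabilityMeasure (volume : Measure Ω)]
    (R α β σ : ℝ) (hR : 0 < R) (hβ : 0 < β) (hσ : 0 < σ)
    (γ a b c : ℝ)
    (hγ : γ = 40 / β + 1)
    (ha : a = 40 / (R ^ 2 * β * Real.sqrt Real.pi) *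
      Real.exp (2 * (Real.log 10) ^ 2 * σ ^ 2 / β ^ 2 - 2 * (Real.log 10) * α / β))
    (hb : b = -10 * Real.sqrt 2 / ((Real.log 10) * σ))
    (hc : c = (-α - β * Real.logb 10 R) / (Real.sqrt 2 * σ) - 20 / (β * b))
    (D X : Ω → ℝ) (hD : Measurable D) (hX : Measurable X)
    (hindep : ProbabilityTheory.IndepFun D X)
    (hDlaw : Measure.map D (volume : Measure Ω) =
      volume.withDensity (fun d => ENNReal.ofReal (if d ∈ Set.Ioo 0 R then 2 * d / R ^ 2 else 0)))
    (hXlaw : Measure.map X (volume : Measure Ω) = ProbabilityTheory.gaussianReal 0 (Real.toNNReal (σ ^ 2)))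
    (G : Ω → ℝ)
    (hG : G = fun ω => (10 : ℝ) ^ (-(α + β * Real.logb 10 (D ω) + X ω) / 20)) :
    Measure.map G (volume : Measure Ω) = volume.withDensity
      (fun g => ENNReal.ofReal (if 0 < g then a * g ^ (-γ) * Qfun b c g else 0)) := by
  set v := Real.toNNReal (σ ^ 2) with hv
  have hv0 : v ≠ 0 := by
    rw [hv]
    exact (Real.toNNReal_pos.2 (by positivity)).ne'
  set pD : ℝ → ℝ≥0∞ :=
    fun d => ENNReal.ofReal (if d ∈ Set.Ioo 0 R then 2 * d / R ^ 2 else 0) with hpD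
  have hpDm : Measurable pD :=
    (Measurable.ite measurableSet_Ioo (by fun_prop) measurable_const).ennreal_ofReal
  have hpD0 : ∀ d ∉ Ioi (0 : ℝ), pD d = 0 := fun d hd => by
    have : d ∉ Ioo 0 R := fun h => hd h.1
    rw [hpD]
    simp only [if_neg this, ENNReal.ofReal_zero]
  set f : ℝ × ℝ → ℝ := fun q => (10 : ℝ) ^ (-(α + β * Real.logb 10 q.1 + q.2) / 20)
  have hfm : Measurable f := by
    unfold f Real.logb
    fun_prop
  have hjoint := (ProbabilityTheory.indepFun_iff_map_prod_eq_prod_map_map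
    hD.aemeasurable hX.aemeasurable).1 hindep
  have hfd : Measurable fun q : ℝ × ℝ => fadingDist α β q.1 q.2 := by
    unfold fadingDist
    fun_prop
  have hGf : G = f ∘ fun ω => (D ω, X ω) := hG
  rw [hGf, ← Measure.map_map hfm (hD.prodMk hX), hjoint, hDlaw, hXlaw,
    ProbabilityTheory.gaussianReal_of_var_ne_zero 0 hv0]
  ext A hA
  have hpre : MeasurableSet (f ⁻¹' A) := hfm hA
  rw [Measure.map_apply hfm hA, Measure.prod_apply_symm hpre,
    lintegral_withDensity_eq_lintegral_mul _ (ProbabilityTheory.measurable_gaussianPDF 0 v)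
      (measurable_measure_prodMk_right hpre), withDensity_apply _ hA]
  have hinner : ∀ x, (volume.withDensity pD) ((fun d => (d, x)) ⁻¹' (f ⁻¹' A)) =
      ∫⁻ g in Ioi 0, A.indicator (fun g => ENNReal.ofReal (20 / β * (fadingDist α β x g / g)) *
        pD (fadingDist α β x g)) g := by
    intro x
    have hs : MeasurableSet ((fun d => (d, x)) ⁻¹' (f ⁻¹' A)) := measurable_prodMk_right hpre
    rw [withDensity_apply _ hs, ← lintegral_indicator hs]
    have hsupp : ∀ d ∉ Ioi (0 : ℝ), ((fun d => (d, x)) ⁻¹' (f ⁻¹' A)).indicator pD d = 0 :=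
      fun d hd => by simp [hpD0 d hd]
    rw [← setLIntegral_eq_of_support_subset (s := Ioi 0)
      (fun d hd => by_contra fun h => hd (hsupp d h)), lintegral_Ioi_fadingDist α x hβ]
    refine setLIntegral_congr_fun measurableSet_Ioi fun g hg => ?_
    have hmem : fadingDist α β x g ∈ (fun d => (d, x)) ⁻¹' (f ⁻¹' A) ↔ g ∈ A := by
      change (10 : ℝ) ^ (-(α + β * Real.logb 10 (fadingDist α β x g) + x) / 20) ∈ A ↔ g ∈ A
      rw [fading_fadingDist α x hβ hg]
    by_cases h : g ∈ A
    · simp only [indicator_of_mem h, indicator_of_mem (hmem.2 h)]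
    · simp only [indicator_of_notMem h, indicator_of_notMem (mt hmem.1 h), mul_zero]
  simp only [Pi.mul_apply, hinner]
  have hind : ∀ x, ProbabilityTheory.gaussianPDF 0 v x * (∫⁻ g in Ioi 0,
      A.indicator (fun g => ENNReal.ofReal (20 / β * (fadingDist α β x g / g)) *
        pD (fadingDist α β x g)) g) =
      ∫⁻ g in A ∩ Ioi 0, ProbabilityTheory.gaussianPDF 0 v x *
        (ENNReal.ofReal (20 / β * (fadingDist α β x g / g)) * pD (fadingDist α β x g)) := by
    intro x
    rw [setLIntegral_indicator hA, lintegral_const_mul]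
    have : Measurable fun g => fadingDist α β x g := hfd.comp measurable_prodMk_left
    fun_prop
  simp only [hind]
  rw [lintegral_lintegral_swap]
  · rw [setLIntegral_congr_fun (hA.inter measurableSet_Ioi) fun g hg =>
      lintegral_gaussianPDF_mul_fading hR hβ hσ hγ ha hb hc hg.2,
      ← lintegral_indicator (hA.inter measurableSet_Ioi), ← lintegral_indicator hA]
    refine lintegral_congr fun g => ?_
    by_cases h1 : g ∈ A <;> by_cases h2 : 0 < g <;> simp [h1, h2]
  · have := ProbabilityTheory.measurable_gaussianPDF 0 v
    refine Measurable.aemeasurable ?_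
    change Measurable fun q : ℝ × ℝ => ProbabilityTheory.gaussianPDF 0 v q.1 *
      (ENNReal.ofReal (20 / β * (fadingDist α β q.1 q.2 / q.2)) * pD (fadingDist α β q.1 q.2))
    fun_prop
end
end

section
/- For every x̃ ∈ ℂ, the denominator m(x̃) = (1−λ)·φ_{τ²}(x̃) + λ·∫_ℂ p_H(x)·φ_{τ²}(x̃ − x) dx is strictly positive, and the Bayes posterior mean satisfies (λ·∫_ℂ x·p_H(x)·φ_{τ²}(x̃ − x) dx) / m(x̃) = x̃·ν₁(|x̃|²)/ξ₁(|x̃|²). (This is the MMSE denoiser E[X | X̃ = x̃] for the prior (1−λ)δ₀ + λ·p_H on ℂ under additive complex Gaussian noise of variance τ².) -/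
open MeasureTheory Set
open scoped ENNReal

noncomputable section

/-- Circularly symmetric complex Gaussian density of variance `v` on `ℂ ≅ ℝ²`. -/
def cgauss (v : ℝ) (x : ℂ) : ℝ := (Real.pi * v)⁻¹ * Real.exp (-‖x‖ ^ 2 / v)

/-- Channel density `p_H(h) = (a/π)∫₀^∞ g^{-γ-2} Q(g) exp(-|h|²/g²) dg`. -/
def pH (a γ b c : ℝ) (h : ℂ) : ℝ :=
  (a / Real.pi) * ∫ g in Set.Ioi (0 : ℝ), g ^ (-γ - 2) * Qfun b c g * Real.exp (-‖h‖ ^ 2 / g ^ 2)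

/-- `ν_i(s) = ∫₀^∞ g^{2-γ} Q(g) (g²+τ²)^{-(i+1)} exp(-s/(g²+τ²)) dg`. -/
def nufun (γ b c τ : ℝ) (i : ℕ) (s : ℝ) : ℝ :=
  ∫ g in Set.Ioi (0 : ℝ),
    g ^ (2 - γ) * Qfun b c g / (g ^ 2 + τ ^ 2) ^ (i + 1) * Real.exp (-s / (g ^ 2 + τ ^ 2))

/-- `ξ_i(s) = ((1-λ)/(λ a τ^{2i})) exp(-s/τ²) + ∫₀^∞ g^{-γ} Q(g) (g²+τ²)^{-i} exp(-s/(g²+τ²)) dg`. -/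
def xifun (a γ b c τ lam : ℝ) (i : ℕ) (s : ℝ) : ℝ :=
  (1 - lam) / (lam * a * τ ^ (2 * i)) * Real.exp (-s / τ ^ 2) +
    ∫ g in Set.Ioi (0 : ℝ),
      g ^ (-γ) * Qfun b c g / (g ^ 2 + τ ^ 2) ^ i * Real.exp (-s / (g ^ 2 + τ ^ 2))

theorem integral_exp_neg_norm_sq_div {w : ℝ} (hw : 0 < w) :
    ∫ x : ℂ, Real.exp (-‖x‖ ^ 2 / w) = Real.pi * w := by
  have h := GaussianFourier.integral_rexp_neg_mul_sq_norm (V := ℂ) (inv_pos.2 hw)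
  rw [Complex.finrank_real_complex] at h
  norm_num at h
  rw [← h]
  congr 1 with x
  congr 1
  field_simp

theorem integrable_exp_neg_norm_sq_div {w : ℝ} (hw : 0 < w) :
    Integrable fun x : ℂ => Real.exp (-‖x‖ ^ 2 / w) := by
  by_contra h
  have := integral_exp_neg_norm_sq_div hw
  rw [integral_undef h] at this
  have : 0 < Real.pi * w := by positivity
  linarith

theorem mul_exp_neg_sq_div_le {w t : ℝ} (hw : 0 < w) :
    t * Real.exp (-t ^ 2 / w) ≤ (1 + 2 * w) * Real.exp (-t ^ 2 / (2 * w)) := by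
  have h1 : t ^ 2 / (2 * w) + 1 ≤ Real.exp (t ^ 2 / (2 * w)) := Real.add_one_le_exp _
  have h2 : t ≤ (1 + 2 * w) * Real.exp (t ^ 2 / (2 * w)) := by
    have h4 : 2 * w * (t ^ 2 / (2 * w)) = t ^ 2 := by field_simp
    have h5 : 0 ≤ t ^ 2 / (2 * w) := by positivity
    nlinarith [sq_nonneg (t - 1)]
  have h3 : Real.exp (-t ^ 2 / (2 * w)) =
      Real.exp (t ^ 2 / (2 * w)) * Real.exp (-t ^ 2 / w) := by
    rw [← Real.exp_add]
    congr 1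
    field_simp
    ring
  rw [h3, ← mul_assoc]
  exact mul_le_mul_of_nonneg_right h2 (Real.exp_pos _).le

theorem integrable_exp_neg_norm_sq_div_smul_id {w : ℝ} (hw : 0 < w) :
    Integrable fun x : ℂ => Real.exp (-‖x‖ ^ 2 / w) • x := by
  refine ((integrable_exp_neg_norm_sq_div (w := 2 * w) (by positivity)).const_mul
    (1 + 2 * w)).mono' (by fun_prop) (Filter.Eventually.of_forall fun x => ?_)
  rw [norm_smul, Real.norm_eq_abs, Real.abs_exp, mul_comm]
  exact mul_exp_neg_sq_div_le hw

theorem integral_exp_neg_norm_sq_div_smul_id {w : ℝ} :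
    ∫ x : ℂ, Real.exp (-‖x‖ ^ 2 / w) • x = 0 := by
  have h := integral_neg_eq_self (fun x : ℂ => Real.exp (-‖x‖ ^ 2 / w) • x) volume
  simp only [norm_neg, smul_neg, integral_neg] at h
  exact self_eq_neg.1 h.symm

theorem exp_mul_cgauss_eq {u v : ℝ} (hu : 0 < u) (hv : 0 < v) (x y : ℂ) :
    Real.exp (-‖x‖ ^ 2 / u) * cgauss v (y - x) =
      (Real.pi * v)⁻¹ * Real.exp (-‖y‖ ^ 2 / (u + v)) *
        Real.exp (-‖x - ((u / (u + v) : ℝ) : ℂ) * y‖ ^ 2 / (u * v / (u + v))) := by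
  rw [cgauss, mul_left_comm, mul_assoc, ← Real.exp_add, ← Real.exp_add]
  congr 2
  simp only [Complex.sq_norm, Complex.normSq_apply, Complex.sub_re, Complex.sub_im,
    Complex.re_ofReal_mul, Complex.im_ofReal_mul]
  field_simp
  ring

theorem integral_exp_mul_cgauss {u v : ℝ} (hu : 0 < u) (hv : 0 < v) (y : ℂ) :
    ∫ x : ℂ, Real.exp (-‖x‖ ^ 2 / u) * cgauss v (y - x) =
      u / (u + v) * Real.exp (-‖y‖ ^ 2 / (u + v)) := by
  simp_rw [exp_mul_cgauss_eq hu hv]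
  rw [integral_const_mul,
    integral_sub_right_eq_self (fun x : ℂ => Real.exp (-‖x‖ ^ 2 / (u * v / (u + v)))),
    integral_exp_neg_norm_sq_div (by positivity)]
  field_simp

theorem integral_exp_mul_cgauss_smul_id {u v : ℝ} (hu : 0 < u) (hv : 0 < v) (y : ℂ) :
    ∫ x : ℂ, (Real.exp (-‖x‖ ^ 2 / u) * cgauss v (y - x)) • x =
      ((u / (u + v)) ^ 2 * Real.exp (-‖y‖ ^ 2 / (u + v))) • y := by
  have hw : 0 < u * v / (u + v) := by positivity
  simp_rw [exp_mul_cgauss_eq hu hv, mul_smul _ (Real.exp (-‖_ - _‖ ^ 2 / _))]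
  rw [integral_smul, ← integral_add_right_eq_self _ (((u / (u + v) : ℝ) : ℂ) * y)]
  simp only [add_sub_cancel_right, smul_add]
  rw [integral_add (integrable_exp_neg_norm_sq_div_smul_id hw)
      ((integrable_exp_neg_norm_sq_div hw).smul_const _),
    integral_exp_neg_norm_sq_div_smul_id, integral_smul_const,
    integral_exp_neg_norm_sq_div hw, zero_add, ← Complex.real_smul, smul_smul, smul_smul]
  congr 1
  field_simp

theorem integrable_exp_neg_sq : Integrable fun s : ℝ => Real.exp (-s ^ 2) := by
  simpa using integrable_exp_neg_mul_sq one_pos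

theorem Qfun_nonneg (b c g : ℝ) : 0 ≤ Qfun b c g :=
  integral_nonneg fun _ => (Real.exp_pos _).le

theorem measurable_Qfun (b c : ℝ) : Measurable (Qfun b c) := by
  have h : Antitone fun t : ℝ => ∫ s in Set.Ioi t, Real.exp (-s ^ 2) := fun t t' htt =>
    setIntegral_mono_set integrable_exp_neg_sq.integrableOn
      (Filter.Eventually.of_forall fun _ => (Real.exp_pos _).le)
      (Set.Ioi_subset_Ioi htt).eventuallyLE
  exact h.measurable.comp ((Real.measurable_log.const_mul b).add_const c)

theorem exists_Qfun_le_mul_exp {K : ℝ} (hK : 0 ≤ K) (b c : ℝ) :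
    ∃ M : ℝ, 0 ≤ M ∧ ∀ g, Qfun b c g ≤ M * Real.exp (-K * (b * Real.log g + c)) := by
  have hi : Integrable fun s : ℝ => Real.exp (-(1 / 2) * s ^ 2) :=
    integrable_exp_neg_mul_sq (by norm_num)
  refine ⟨Real.exp (K ^ 2 / 2) * ∫ s : ℝ, Real.exp (-(1 / 2) * s ^ 2),
    mul_nonneg (Real.exp_pos _).le (integral_nonneg fun _ => (Real.exp_pos _).le), fun g => ?_⟩
  rw [mul_comm, ← mul_assoc, ← integral_const_mul]
  refine (setIntegral_mono_on integrable_exp_neg_sq.integrableOn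
    (hi.const_mul _).integrableOn measurableSet_Ioi fun s hs => ?_).trans
    (setIntegral_le_integral (hi.const_mul _) (Filter.Eventually.of_forall fun _ => by positivity))
  rw [← Real.exp_add, ← Real.exp_add]
  refine Real.exp_le_exp.2 ?_
  have := mul_le_mul_of_nonneg_left (le_of_lt hs) hK
  nlinarith [sq_nonneg (K - s)]

theorem integrableOn_rpow_mul_Qfun {γ b : ℝ} (hγ : 1 < γ) (hb : b < 0) (c : ℝ) :
    IntegrableOn (fun g : ℝ => g ^ (-γ) * Qfun b c g) (Set.Ioi 0) := by
  have hmeas : Measurable fun g : ℝ => g ^ (-γ) * Qfun b c g :=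
    (measurable_id.pow_const _).mul (measurable_Qfun b c)
  rw [← Set.Ioc_union_Ioi_eq_Ioi zero_le_one]
  refine IntegrableOn.union ?_ ?_
  · obtain ⟨M, hM, hQ⟩ := exists_Qfun_le_mul_exp (K := γ / (-b))
      (div_nonneg (by linarith) (by linarith)) b c
    refine Measure.integrableOn_of_bounded (M := M * Real.exp (-(γ / (-b)) * c)) (by simp)
      hmeas.aestronglyMeasurable ?_
    refine (ae_restrict_iff' measurableSet_Ioc).2 (Filter.Eventually.of_forall fun g hg => ?_)
    have hg0 : 0 < g := hg.1
    rw [Real.norm_of_nonneg (mul_nonneg (by positivity) (Qfun_nonneg _ _ _))]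
    refine (mul_le_mul_of_nonneg_left (hQ g) (by positivity)).trans_eq ?_
    rw [Real.rpow_def_of_pos hg0, mul_left_comm, ← Real.exp_add]
    congr 2
    field_simp [hb.ne]
    ring
  · obtain ⟨M, hM, hQ⟩ := exists_Qfun_le_mul_exp le_rfl b c
    refine ((integrableOn_Ioi_rpow_of_lt (a := -γ) (by linarith) one_pos).const_mul M).mono'
      hmeas.aestronglyMeasurable ?_
    refine (ae_restrict_iff' measurableSet_Ioi).2 (Filter.Eventually.of_forall fun g hg => ?_)
    have hg0 : 0 < g := one_pos.trans hg
    rw [Real.norm_of_nonneg (mul_nonneg (by positivity) (Qfun_nonneg _ _ _)), mul_comm M]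
    refine mul_le_mul_of_nonneg_left ?_ (by positivity)
    simpa using hQ g

theorem integrable_prod_mixture {γ b : ℝ} (hγ : 1 < γ) (hb : b < 0) (c : ℝ) :
    Integrable (fun p : ℂ × ℝ =>
      p.2 ^ (-γ - 2) * Qfun b c p.2 * Real.exp (-‖p.1‖ ^ 2 / p.2 ^ 2))
      ((volume : Measure ℂ).prod (volume.restrict (Set.Ioi (0 : ℝ)))) := by
  have hQ := measurable_Qfun b c
  have hmeas : Measurable fun p : ℂ × ℝ =>
      p.2 ^ (-γ - 2) * Qfun b c p.2 * Real.exp (-‖p.1‖ ^ 2 / p.2 ^ 2) := by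
    exact ((measurable_snd.pow_const _).mul (hQ.comp measurable_snd)).mul (by fun_prop)
  refine (integrable_prod_iff' hmeas.aestronglyMeasurable).2 ⟨?_, ?_⟩
  · refine (ae_restrict_iff' measurableSet_Ioi).2 (Filter.Eventually.of_forall fun g hg => ?_)
    exact (integrable_exp_neg_norm_sq_div (pow_pos hg 2)).const_mul
      (g ^ (-γ - 2) * Qfun b c g)
  · refine ((integrableOn_rpow_mul_Qfun hγ hb c).const_mul Real.pi).congr ?_
    refine (ae_restrict_iff' measurableSet_Ioi).2 (Filter.Eventually.of_forall fun g hg => ?_)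
    have hg0 : 0 < g := hg
    have hn : ∀ x : ℂ, 0 ≤ g ^ (-γ - 2) * Qfun b c g * Real.exp (-‖x‖ ^ 2 / g ^ 2) := fun x =>
      mul_nonneg (mul_nonneg (by positivity) (Qfun_nonneg _ _ _)) (Real.exp_pos _).le
    simp only [Real.norm_of_nonneg (hn _)]
    rw [integral_const_mul, integral_exp_neg_norm_sq_div (pow_pos hg 2),
      Real.rpow_sub hg0, Real.rpow_two]
    field_simp

theorem integral_pH_smul {E : Type*} [NormedAddCommGroup E] [NormedSpace ℝ E]
    [CompleteSpace E] {γ b : ℝ}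
    (hγ : 1 < γ) (hb : b < 0) (a c : ℝ) {k : ℂ → E} (hk : Continuous k) {C : ℝ}
    (hC : ∀ x, ‖k x‖ ≤ C) :
    ∫ x : ℂ, pH a γ b c x • k x = (a / Real.pi) • ∫ g in Set.Ioi (0 : ℝ),
      (g ^ (-γ - 2) * Qfun b c g) • ∫ x : ℂ, Real.exp (-‖x‖ ^ 2 / g ^ 2) • k x := by
  have hint := integrable_prod_mixture hγ hb c
  have hint' : Integrable (Function.uncurry fun (x : ℂ) (g : ℝ) =>
      (g ^ (-γ - 2) * Qfun b c g * Real.exp (-‖x‖ ^ 2 / g ^ 2)) • k x)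
      ((volume : Measure ℂ).prod (volume.restrict (Set.Ioi (0 : ℝ)))) :=
    hint.smul_bdd C (hk.comp continuous_fst).aestronglyMeasurable
      (Filter.Eventually.of_forall fun p => hC p.1)
  simp_rw [pH, mul_smul (a / Real.pi)]
  rw [integral_smul]
  simp_rw [← integral_smul_const]
  rw [integral_integral_swap hint']
  simp_rw [mul_smul _ (Real.exp _), integral_smul]

theorem continuous_cgauss (v : ℝ) : Continuous (cgauss v) := by
  unfold cgauss
  fun_prop

theorem cgauss_nonneg {v : ℝ} (hv : 0 < v) (x : ℂ) : 0 ≤ cgauss v x := by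
  unfold cgauss
  positivity

theorem cgauss_le {v : ℝ} (hv : 0 < v) (x : ℂ) : cgauss v x ≤ (Real.pi * v)⁻¹ := by
  refine mul_le_of_le_one_right (by positivity) (Real.exp_le_one_iff.2 ?_)
  exact div_nonpos_of_nonpos_of_nonneg (by simp) hv.le

theorem norm_mul_cgauss_le {v : ℝ} (hv : 0 < v) (x : ℂ) :
    ‖x‖ * cgauss v x ≤ (Real.pi * v)⁻¹ * (1 + 2 * v) := by
  rw [cgauss, mul_left_comm]
  refine mul_le_mul_of_nonneg_left ((mul_exp_neg_sq_div_le hv).trans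
    (mul_le_of_le_one_right (by positivity) (Real.exp_le_one_iff.2 ?_))) (by positivity)
  exact div_nonpos_of_nonpos_of_nonneg (by simp) (by positivity)

theorem integral_pH_mul_cgauss {γ b τ : ℝ} (hγ : 1 < γ) (hb : b < 0) (a c : ℝ) (hτ : 0 < τ)
    (y : ℂ) :
    ∫ x : ℂ, pH a γ b c x * cgauss (τ ^ 2) (y - x) = a / Real.pi * ∫ g in Set.Ioi (0 : ℝ),
      g ^ (-γ) * Qfun b c g / (g ^ 2 + τ ^ 2) ^ 1 * Real.exp (-‖y‖ ^ 2 / (g ^ 2 + τ ^ 2)) := by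
  have hv : 0 < τ ^ 2 := by positivity
  have h := integral_pH_smul hγ hb a c (k := fun x => cgauss (τ ^ 2) (y - x))
    ((continuous_cgauss _).comp (by fun_prop)) (C := (Real.pi * τ ^ 2)⁻¹) fun x => by
      rw [Real.norm_of_nonneg (cgauss_nonneg hv _)]
      exact cgauss_le hv _
  simp only [smul_eq_mul] at h
  rw [h]
  congr 1
  refine setIntegral_congr_fun measurableSet_Ioi fun g hg => ?_
  have hg0 : 0 < g := hg
  rw [integral_exp_mul_cgauss (pow_pos hg 2) hv, Real.rpow_sub hg0, Real.rpow_two]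
  field_simp

theorem integral_id_mul_pH_mul_cgauss {γ b τ : ℝ} (hγ : 1 < γ) (hb : b < 0) (a c : ℝ)
    (hτ : 0 < τ) (y : ℂ) :
    ∫ x : ℂ, x * ((pH a γ b c x * cgauss (τ ^ 2) (y - x) : ℝ) : ℂ) =
      ((a / Real.pi * nufun γ b c τ 1 (‖y‖ ^ 2) : ℝ) : ℂ) * y := by
  have hv : 0 < τ ^ 2 := by positivity
  have h := integral_pH_smul hγ hb a c (k := fun x => cgauss (τ ^ 2) (y - x) • x)
    (((continuous_cgauss _).comp (by fun_prop)).smul continuous_id)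
    (C := ‖y‖ * (Real.pi * τ ^ 2)⁻¹ + (Real.pi * τ ^ 2)⁻¹ * (1 + 2 * τ ^ 2)) fun x => by
      rw [norm_smul, Real.norm_of_nonneg (cgauss_nonneg hv _), mul_comm]
      have h1 : ‖x‖ ≤ ‖y‖ + ‖y - x‖ := by
        simpa using norm_sub_le y (y - x)
      refine (mul_le_mul_of_nonneg_right h1 (cgauss_nonneg hv _)).trans ?_
      rw [add_mul]
      exact add_le_add (mul_le_mul_of_nonneg_left (cgauss_le hv _) (norm_nonneg _))
        (norm_mul_cgauss_le hv _)
  have hl : ∀ x : ℂ, x * ((pH a γ b c x * cgauss (τ ^ 2) (y - x) : ℝ) : ℂ) =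
      pH a γ b c x • cgauss (τ ^ 2) (y - x) • x := fun x => by
    rw [smul_smul, Complex.real_smul, mul_comm]
  simp_rw [hl]
  rw [h, ← Complex.real_smul, mul_smul, nufun, ← integral_smul_const]
  congr 1
  refine setIntegral_congr_fun measurableSet_Ioi fun g hg => ?_
  have hg0 : 0 < g := hg
  simp only [smul_smul]
  rw [integral_exp_mul_cgauss_smul_id (pow_pos hg 2) hv, smul_smul,
    show (2 - γ : ℝ) = -γ + 2 by ring, Real.rpow_sub hg0, Real.rpow_add hg0, Real.rpow_two]
  congr 1
  field_simp

theorem pH_nonneg {a : ℝ} (ha : 0 ≤ a) (γ b c : ℝ) (x : ℂ) : 0 ≤ pH a γ b c x := by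
  refine mul_nonneg (by positivity) (setIntegral_nonneg measurableSet_Ioi fun g hg => ?_)
  have hg0 : 0 < g := hg
  exact mul_nonneg (mul_nonneg (by positivity) (Qfun_nonneg _ _ _)) (Real.exp_pos _).le

/-- the MMSE denoiser for the prior `(1-λ)δ₀ + λ p_H` under additive complex
Gaussian noise of variance `τ²` equals `x̃ · ν₁(|x̃|²)/ξ₁(|x̃|²)`. -/
theorem stmt2
    (R α β σ : ℝ) (hR : 0 < R) (hβ : 0 < β) (hσ : 0 < σ)
    (γ a b c : ℝ)
    (hγ : γ = 40 / β + 1)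
    (ha : a = 40 / (R ^ 2 * β * Real.sqrt Real.pi) *
      Real.exp (2 * (Real.log 10) ^ 2 * σ ^ 2 / β ^ 2 - 2 * (Real.log 10) * α / β))
    (hb : b = -10 * Real.sqrt 2 / ((Real.log 10) * σ))
    (hc : c = (-α - β * Real.logb 10 R) / (Real.sqrt 2 * σ) - 20 / (β * b))
    (τ lam : ℝ) (hτ : 0 < τ) (hlam : lam ∈ Set.Ioo (0 : ℝ) 1)
    (xt : ℂ)
    (m : ℝ)
    (hm : m = (1 - lam) * cgauss (τ ^ 2) xt +
      lam * ∫ x : ℂ, pH a γ b c x * cgauss (τ ^ 2) (xt - x)) :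
    0 < m ∧
      ((lam : ℂ) * ∫ x : ℂ, x * ((pH a γ b c x * cgauss (τ ^ 2) (xt - x) : ℝ) : ℂ)) / (m : ℂ) =
        xt * ((nufun γ b c τ 1 (‖xt‖ ^ 2) / xifun a γ b c τ lam 1 (‖xt‖ ^ 2) : ℝ) : ℂ) := by
  obtain ⟨hl0, hl1⟩ := hlam
  have hγ1 : 1 < γ := by
    rw [hγ]
    have : 0 < 40 / β := by positivity
    linarith
  have ha0 : 0 < a := by
    rw [ha]
    positivity
  have hb0 : b < 0 := by
    rw [hb]
    have : 0 < Real.log 10 := Real.log_pos (by norm_num)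
    refine div_neg_of_neg_of_pos ?_ (by positivity)
    have : 0 < Real.sqrt 2 := by positivity
    linarith
  have hv : 0 < τ ^ 2 := by positivity
  have hm0 : 0 < m := by
    rw [hm]
    refine add_pos_of_pos_of_nonneg (mul_pos (by linarith) ?_) (mul_nonneg hl0.le
      (integral_nonneg fun x => mul_nonneg (pH_nonneg ha0.le _ _ _ _) (cgauss_nonneg hv _)))
    unfold cgauss
    positivity
  have hmx : m = lam * a / Real.pi * xifun a γ b c τ lam 1 (‖xt‖ ^ 2) := by
    rw [hm, integral_pH_mul_cgauss hγ1 hb0 a c hτ, xifun, cgauss]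
    field_simp
    ring
  have hx : xifun a γ b c τ lam 1 (‖xt‖ ^ 2) ≠ 0 := by
    intro h
    rw [h, mul_zero] at hmx
    exact hm0.ne' hmx
  refine ⟨hm0, ?_⟩
  rw [integral_id_mul_pH_mul_cgauss hγ1 hb0 a c hτ, hmx]
  have hx' := Complex.ofReal_ne_zero.2 hx
  have ha' := Complex.ofReal_ne_zero.2 ha0.ne'
  have hl' := Complex.ofReal_ne_zero.2 hl0.ne'
  have hp' := Complex.ofReal_ne_zero.2 Real.pi_ne_zero
  push_cast
  field_simp
end
end

section
/- Let M ≥ 1 be an integer, Σ an M×M Hermitian positive-definite complex matrix, g > 0, λ ∈ (0,1), and r̃ ∈ ℂ^M (a column vector). Then the denominator D(r̃) = (1−λ)·φ_Σ(r̃) + λ·∫_{ℂ^M} φ_{g²}^{(M)}(r)·φ_Σ(r̃−r) dr is strictly positive and the Bayes posterior mean satisfies (λ·∫_{ℂ^M} r·φ_{g²}^{(M)}(r)·φ_Σ(r̃−r) dr) / D(r̃) = (g^{−2}Σ + I)^{−1} r̃ / (1 + ((1−λ)/λ)·(det(g²I + Σ)/det Σ)·exp(−r̃*(Σ^{−1}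 − (Σ + g²I)^{−1})r̃)), where r̃* denotes the conjugate transpose of r̃ and I the M×M identity matrix. -/
open MeasureTheory Set
open scoped ENNReal ComplexOrder

noncomputable section

/-- Squared Euclidean norm on `ℂ^M ≅ ℝ^{2M}`. -/
def nsq {M : ℕ} (r : Fin M → ℂ) : ℝ := ∑ i, ‖r i‖ ^ 2

/-- Circularly symmetric complex Gaussian density of variance `v` on `ℂ^M ≅ ℝ^{2M}`:
`φ_v^{(M)}(r) = (πv)^{-M} exp(-‖r‖²/v)`. -/
def vgauss (M : ℕ) (v : ℝ) (r : Fin M → ℂ) : ℝ :=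
  ((Real.pi * v) ^ M)⁻¹ * Real.exp (-nsq r / v)

/-- Channel-row density `q_M(r) = a π^{-M} ∫₀^∞ g^{-γ-2M} Q(g) exp(-‖r‖²/g²) dg`. -/
def qM (a γ b c : ℝ) (M : ℕ) (r : Fin M → ℂ) : ℝ :=
  a / Real.pi ^ M *
    ∫ g in Set.Ioi (0 : ℝ), g ^ (-γ - 2 * (M : ℝ)) * Qfun b c g * Real.exp (-nsq r / g ^ 2)

open Matrix in
/-- Circularly symmetric complex Gaussian density with covariance `S` on `ℂ^M`:
`φ_S(u) = (π^M det S)⁻¹ exp(-u* S⁻¹ u)` (the quadratic form and determinant are real for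
Hermitian positive-definite `S`). -/
def mgauss (M : ℕ) (S : Matrix (Fin M) (Fin M) ℂ) (u : Fin M → ℂ) : ℝ :=
  (Real.pi ^ M * S.det.re)⁻¹ * Real.exp (-((star u) ⬝ᵥ (S⁻¹ *ᵥ u)).re)

lemma integral_exp_neg_mul_nsq (M : ℕ) {b : ℝ} (hb : 0 < b) :
    ∫ v : Fin M → ℂ, Real.exp (-b * nsq v) = (Real.pi / b) ^ M := by
  have h : ∀ v : Fin M → ℂ, Real.exp (-b * nsq v) = ∏ i, Real.exp (-b * ‖v i‖ ^ 2) := by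
    intro v
    rw [← Real.exp_sum, nsq, Finset.mul_sum]
  simp_rw [h]
  rw [integral_fintype_prod_volume_eq_prod (fun (_ : Fin M) (z : ℂ) => Real.exp (-b * ‖z‖ ^ 2))]
  rw [Finset.prod_const, GaussianFourier.integral_rexp_neg_mul_sq_norm hb]
  simp [Complex.finrank_real_complex]

lemma integrable_exp_neg_mul_nsq (M : ℕ) {b : ℝ} (hb : 0 < b) :
    Integrable fun v : Fin M → ℂ => Real.exp (-b * nsq v) := by
  apply Integrable.of_integral_ne_zero
  rw [integral_exp_neg_mul_nsq M hb]
  have := Real.pi_pos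
  positivity

lemma continuous_nsq (M : ℕ) : Continuous (nsq : (Fin M → ℂ) → ℝ) := by
  unfold nsq
  fun_prop

lemma norm_sq_le_nsq {M : ℕ} (v : Fin M → ℂ) : ‖v‖ ^ 2 ≤ nsq v := by
  have h0 : 0 ≤ nsq v := Finset.sum_nonneg fun i _ => by positivity
  refine (Real.le_sqrt (norm_nonneg _) h0).1 ?_
  refine (pi_norm_le_iff_of_nonneg (Real.sqrt_nonneg _)).2 fun i => ?_
  refine Real.le_sqrt_of_sq_le ?_
  exact Finset.single_le_sum (f := fun i => ‖v i‖ ^ 2) (fun i _ => by positivity)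
    (Finset.mem_univ i)

lemma integrable_exp_neg_nsq_smul (M : ℕ) :
    Integrable fun v : Fin M → ℂ => Real.exp (-nsq v) • v := by
  refine (integrable_exp_neg_mul_nsq M (b := 1 / 2) (by norm_num)).mono' ?_ ?_
  · have := continuous_nsq M
    exact Continuous.aestronglyMeasurable (by fun_prop)
  · refine Filter.Eventually.of_forall fun v => ?_
    rw [norm_smul, Real.norm_of_nonneg (Real.exp_pos _).le]
    have h1 : ‖v‖ ≤ Real.exp (1 / 2 * nsq v) := by
      have := norm_sq_le_nsq v
      nlinarith [Real.add_one_le_exp (1 / 2 * nsq v), sq_nonneg (‖v‖ - 1)]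
    calc Real.exp (-nsq v) * ‖v‖ ≤ Real.exp (-nsq v) * Real.exp (1 / 2 * nsq v) := by gcongr
      _ = Real.exp (-(1 / 2) * nsq v) := by rw [← Real.exp_add]; ring_nf

section LinearChangeOfVariables

variable {M : ℕ} {B : Matrix (Fin M) (Fin M) ℂ}

lemma map_mulVec_volume (hB : IsUnit B.det) :
    Measure.map (fun u : Fin M → ℂ => B.mulVec u) volume =
      ENNReal.ofReal (Complex.normSq B.det)⁻¹ • volume := by
  have hdet : LinearMap.det ((Matrix.toLin' B).restrictScalars ℝ) = Complex.normSq B.det := by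
    rw [LinearMap.det_restrictScalars, LinearMap.det_toLin', Algebra.norm_complex_apply]
  have h := Measure.map_linearMap_addHaar_eq_smul_addHaar (volume : Measure (Fin M → ℂ))
    (f := (Matrix.toLin' B).restrictScalars ℝ)
    (by rw [hdet]; simpa [Complex.normSq_eq_zero] using hB.ne_zero)
  rw [hdet, abs_of_nonneg (inv_nonneg.2 (Complex.normSq_nonneg _))] at h
  exact h

lemma measurableEmbedding_mulVec (hB : IsUnit B.det) :
    MeasurableEmbedding fun u : Fin M → ℂ => B.mulVec u :=
  Continuous.measurableEmbedding (by fun_prop)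
    (Matrix.mulVec_injective_of_isUnit ((Matrix.isUnit_iff_isUnit_det B).2 hB))

lemma integral_comp_mulVec {E : Type*} [NormedAddCommGroup E] [NormedSpace ℝ E]
    (hB : IsUnit B.det) (f : (Fin M → ℂ) → E) :
    ∫ u, f (B.mulVec u) = (Complex.normSq B.det)⁻¹ • ∫ v, f v := by
  rw [← (measurableEmbedding_mulVec hB).integral_map, map_mulVec_volume hB, integral_smul_measure,
    ENNReal.toReal_ofReal (inv_nonneg.2 (Complex.normSq_nonneg _))]

lemma integrable_comp_mulVec {E : Type*} [NormedAddCommGroup E]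
    (hB : IsUnit B.det) {f : (Fin M → ℂ) → E} (hf : Integrable f) :
    Integrable fun u => f (B.mulVec u) := by
  refine ((measurableEmbedding_mulVec hB).integrable_map_iff (g := f)).1 ?_
  rw [map_mulVec_volume hB]
  exact hf.smul_measure ENNReal.ofReal_ne_top

end LinearChangeOfVariables

section ComplexGaussian

open Matrix

lemma star_dotProduct_self_re {M : ℕ} (v : Fin M → ℂ) : (star v ⬝ᵥ v).re = nsq v := by
  simp [dotProduct, nsq, ← Complex.normSq_eq_norm_sq, Complex.normSq_apply]

variable {M : ℕ} {A : Matrix (Fin M) (Fin M) ℂ}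

open scoped MatrixOrder in
lemma Matrix.PosDef.exists_factor (hA : A.PosDef) :
    ∃ B : Matrix (Fin M) (Fin M) ℂ, IsUnit B.det ∧ A.det.re = Complex.normSq B.det ∧
      ∀ u, (star u ⬝ᵥ (A *ᵥ u)).re = nsq (B *ᵥ u) := by
  obtain ⟨B, rfl⟩ := CStarAlgebra.nonneg_iff_eq_star_mul_self.mp hA.posSemidef.nonneg
  rw [star_eq_conjTranspose] at *
  have h : (Bᴴ * B).det = Complex.normSq B.det := by
    rw [det_mul, det_conjTranspose, Complex.normSq_eq_conj_mul_self]
    rfl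
  refine ⟨B, ?_, by simp [h], fun u => ?_⟩
  · have := hA.det_pos.ne'
    rw [h] at this
    rw [isUnit_iff_ne_zero]
    intro h0
    simp [h0] at this
  · rw [← mulVec_mulVec, ← star_dotProduct_self_re, star_mulVec, dotProduct_mulVec]

lemma integral_exp_neg_quadratic (hA : A.PosDef) :
    ∫ u, Real.exp (-(star u ⬝ᵥ (A *ᵥ u)).re) = Real.pi ^ M / A.det.re := by
  obtain ⟨B, hB, hdet, hq⟩ := hA.exists_factor
  simp_rw [hq]
  rw [integral_comp_mulVec hB (fun v => Real.exp (-nsq v)), hdet]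
  have := integral_exp_neg_mul_nsq M one_pos
  simp only [neg_mul, one_mul, div_one] at this
  rw [this, smul_eq_mul, div_eq_inv_mul]

lemma integrable_exp_neg_quadratic (hA : A.PosDef) :
    Integrable fun u => Real.exp (-(star u ⬝ᵥ (A *ᵥ u)).re) := by
  obtain ⟨B, hB, -, hq⟩ := hA.exists_factor
  simp_rw [hq]
  have := integrable_exp_neg_mul_nsq M one_pos
  simp only [neg_mul, one_mul] at this
  exact integrable_comp_mulVec hB this

lemma integrable_exp_neg_quadratic_smul (hA : A.PosDef) :
    Integrable fun u => Real.exp (-(star u ⬝ᵥ (A *ᵥ u)).re) • u := by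
  obtain ⟨B, hB, -, hq⟩ := hA.exists_factor
  simp_rw [hq]
  have h := (((Matrix.toLin' B⁻¹).restrictScalars ℝ).toContinuousLinearMap).integrable_comp
    (integrable_comp_mulVec hB (integrable_exp_neg_nsq_smul M))
  refine h.congr (Filter.Eventually.of_forall fun u => ?_)
  simp [nonsing_inv_mul _ hB]

lemma integral_exp_neg_quadratic_smul (A : Matrix (Fin M) (Fin M) ℂ) :
    ∫ u, Real.exp (-(star u ⬝ᵥ (A *ᵥ u)).re) • u = 0 := by
  have h := integral_neg_eq_self
    (fun u : Fin M → ℂ => Real.exp (-(star u ⬝ᵥ (A *ᵥ u)).re) • u) volume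
  simp only [star_neg, mulVec_neg, neg_dotProduct_neg, smul_neg, integral_neg] at h
  exact self_eq_neg.1 h.symm

lemma integral_exp_neg_quadratic_sub_smul (hA : A.PosDef) (w : Fin M → ℂ) :
    ∫ r, Real.exp (-(star (r - w) ⬝ᵥ (A *ᵥ (r - w))).re) • r =
      (∫ r, Real.exp (-(star (r - w) ⬝ᵥ (A *ᵥ (r - w))).re)) • w := by
  rw [integral_sub_right_eq_self (fun r => Real.exp (-(star r ⬝ᵥ (A *ᵥ r)).re)) w,
    ← integral_add_right_eq_self _ w]
  simp only [add_sub_cancel_right, smul_add]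
  rw [integral_add (integrable_exp_neg_quadratic_smul hA)
    ((integrable_exp_neg_quadratic hA).smul_const w), integral_exp_neg_quadratic_smul, zero_add,
    integral_smul_const]

/-- Completing the square in the exponent of the joint density. -/
lemma complete_square {S : Matrix (Fin M) (Fin M) ℂ} (hS : S.PosDef) (t : ℝ) (r w rt : Fin M → ℂ)
    (hw : rt = w + t • (S *ᵥ w)) :
    t * nsq r + (star (rt - r) ⬝ᵥ (S⁻¹ *ᵥ (rt - r))).re =
      (star (r - w) ⬝ᵥ (((t : ℂ) • 1 + S⁻¹) *ᵥ (r - w))).re + t * (star rt ⬝ᵥ w).re := by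
  have hdet : IsUnit S.det := (isUnit_iff_isUnit_det S).1 hS.isUnit
  have hSS : S⁻¹ *ᵥ (S *ᵥ w) = w := by simp [nonsing_inv_mul _ hdet]
  have hherm : ∀ x y : Fin M → ℂ, star (S *ᵥ x) ⬝ᵥ y = star x ⬝ᵥ (S *ᵥ y) := fun x y => by
    rw [star_mulVec, hS.isHermitian.eq, dotProduct_mulVec]
  have hinv : ∀ x y : Fin M → ℂ, star (S *ᵥ x) ⬝ᵥ (S⁻¹ *ᵥ y) = star x ⬝ᵥ y := fun x y => by
    rw [hherm]; simp [mul_nonsing_inv _ hdet]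
  have hcomm : (star r ⬝ᵥ w).re = (star w ⬝ᵥ r).re := by
    rw [star_dotProduct, Complex.star_def, Complex.conj_re, dotProduct_comm]
  have hreal : t * nsq r = (star r ⬝ᵥ ((t : ℂ) • r)).re := by
    rw [dotProduct_smul, smul_eq_mul, Complex.re_ofReal_mul, star_dotProduct_self_re]
  rw [hreal, hw]
  simp only [mulVec_add, mulVec_sub, add_mulVec, star_add, star_sub, star_smul, mulVec_smul,
    dotProduct_add, add_dotProduct, sub_dotProduct, dotProduct_sub, smul_mulVec, one_mulVec,
    dotProduct_smul, smul_dotProduct, hSS, hinv, hherm, Complex.add_re, Complex.sub_re,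
    Complex.real_smul, smul_eq_mul, Complex.re_ofReal_mul, star_trivial, hcomm]
  ring

end ComplexGaussian

section Posterior

open Matrix

variable {M : ℕ} {S : Matrix (Fin M) (Fin M) ℂ} {g : ℝ}

lemma Matrix.PosDef.smul_one_add (hS : S.PosDef) {t : ℝ} (ht : 0 < t) :
    ((t : ℂ) • (1 : Matrix (Fin M) (Fin M) ℂ) + S).PosDef :=
  (PosDef.one.smul (by exact_mod_cast ht)).add hS

lemma Matrix.PosDef.det_re_pos (hS : S.PosDef) : 0 < S.det.re :=
  (Complex.pos_iff.1 hS.det_pos).1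

lemma Matrix.PosDef.det_eq_ofReal_re (hS : S.PosDef) : S.det = (S.det.re : ℂ) :=
  Complex.ext rfl (by simpa using (Complex.pos_iff.1 hS.det_pos).2.symm)

lemma mgauss_pos (hS : S.PosDef) (u : Fin M → ℂ) : 0 < mgauss M S u := by
  have := hS.det_re_pos
  have := Real.pi_pos
  unfold mgauss
  positivity

lemma inv_sq_smul_add_one_eq (hg : 0 < g) :
    ((g : ℂ) ^ 2)⁻¹ • S + 1 = ((g : ℂ) ^ 2)⁻¹ • ((g : ℂ) ^ 2 • 1 + S) := by
  have : (g : ℂ) ^ 2 ≠ 0 := by exact_mod_cast (pow_pos hg 2).ne'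
  rw [smul_add, smul_smul, inv_mul_cancel₀ this, one_smul, add_comm]

lemma det_re_precision (hS : S.PosDef) (hg : 0 < g) :
    ((((g ^ 2)⁻¹ : ℝ) : ℂ) • 1 + S⁻¹).det.re =
      ((g : ℂ) ^ 2 • 1 + S).det.re / ((g ^ 2) ^ M * S.det.re) := by
  have hdet : IsUnit S.det := (isUnit_iff_isUnit_det S).1 hS.isUnit
  have hG := hS.smul_one_add (pow_pos hg 2)
  have hA := hS.inv.smul_one_add (inv_pos.2 (pow_pos hg 2))
  have hmul : ((((g ^ 2)⁻¹ : ℝ) : ℂ) • 1 + S⁻¹) * S =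
      (((g ^ 2)⁻¹ : ℝ) : ℂ) • (((g ^ 2 : ℝ) : ℂ) • 1 + S) := by
    push_cast
    rw [← inv_sq_smul_add_one_eq hg, add_mul, nonsing_inv_mul _ hdet]
    simp
  have h := congrArg det hmul
  rw [det_mul, det_smul, hS.det_eq_ofReal_re, hA.det_eq_ofReal_re, hG.det_eq_ofReal_re,
    Fintype.card_fin] at h
  norm_cast at h
  rw [← Complex.coe_smul, ← Complex.coe_smul] at h
  have h1 := hS.det_re_pos
  have : (g ^ 2) ^ M ≠ 0 := by positivity
  push_cast at h ⊢
  rw [eq_div_iff (by positivity)]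
  rw [inv_pow, inv_mul_eq_div, eq_div_iff this] at h
  linear_combination h


lemma shrinkage_mulVec_eq (hS : S.PosDef) (hg : 0 < g) (rt : Fin M → ℂ) :
    (((g : ℂ) ^ 2)⁻¹ • S + 1)⁻¹ *ᵥ rt = (g ^ 2) • (((g : ℂ) ^ 2 • 1 + S)⁻¹ *ᵥ rt) := by
  have hg2 : (g : ℂ) ^ 2 ≠ 0 := by exact_mod_cast (pow_pos hg 2).ne'
  have hG : IsUnit ((g : ℂ) ^ 2 • 1 + S).det := by
    have := (hS.smul_one_add (pow_pos hg 2)).isUnit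
    push_cast at this
    exact (isUnit_iff_isUnit_det _).1 this
  have h : (((g : ℂ) ^ 2)⁻¹ • S + 1)⁻¹ = (g : ℂ) ^ 2 • ((g : ℂ) ^ 2 • 1 + S)⁻¹ := by
    apply inv_eq_left_inv
    rw [inv_sq_smul_add_one_eq hg, smul_mul_smul_comm, mul_inv_cancel₀ hg2, one_smul,
      nonsing_inv_mul _ hG]
  rw [h, smul_mulVec]
  ext i
  simp

lemma eq_shrinkage_add (hS : S.PosDef) (hg : 0 < g) (rt : Fin M → ℂ) :
    rt = (((g : ℂ) ^ 2)⁻¹ • S + 1)⁻¹ *ᵥ rt +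
      (g ^ 2)⁻¹ • (S *ᵥ ((((g : ℂ) ^ 2)⁻¹ • S + 1)⁻¹ *ᵥ rt)) := by
  have hK : IsUnit (((g : ℂ) ^ 2)⁻¹ • S + 1).det := by
    have := (PosDef.one.add (hS.smul (α := ℂ) (a := (((g ^ 2)⁻¹ : ℝ) : ℂ))
      (by exact_mod_cast inv_pos.2 (pow_pos hg 2)))).isUnit
    push_cast at this
    rw [add_comm]
    exact (isUnit_iff_isUnit_det _).1 this
  have h : (((g : ℂ) ^ 2)⁻¹ • S + 1) *ᵥ ((((g : ℂ) ^ 2)⁻¹ • S + 1)⁻¹ *ᵥ rt) = rt := by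
    rw [mulVec_mulVec, mul_nonsing_inv _ hK, one_mulVec]
  nth_rw 1 [← h]
  rw [add_mulVec, one_mulVec, smul_mulVec, add_comm]
  congr 1
  ext i
  simp

/-- The joint density is, up to a constant, a Gaussian centred at the linear MMSE estimate. -/
lemma vgauss_mul_mgauss (hS : S.PosDef) (hg : 0 < g) {rt w : Fin M → ℂ}
    (hw : w = (((g : ℂ) ^ 2)⁻¹ • S + 1)⁻¹ *ᵥ rt) (r : Fin M → ℂ) :
    vgauss M (g ^ 2) r * mgauss M S (rt - r) =
      ((Real.pi * g ^ 2) ^ M)⁻¹ * (Real.pi ^ M * S.det.re)⁻¹ *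
        Real.exp (-((g ^ 2)⁻¹ * (star rt ⬝ᵥ w).re)) *
        Real.exp (-(star (r - w) ⬝ᵥ (((((g ^ 2)⁻¹ : ℝ) : ℂ) • 1 + S⁻¹) *ᵥ (r - w))).re) := by
  have h := complete_square hS (g ^ 2)⁻¹ r w rt (hw ▸ eq_shrinkage_add hS hg rt)
  rw [vgauss, mgauss, mul_mul_mul_comm, ← Real.exp_add, mul_assoc _ (Real.exp _) (Real.exp _),
    ← Real.exp_add]
  congr 2
  rw [div_eq_inv_mul]
  linarith

lemma integral_vgauss_mul_mgauss (hS : S.PosDef) (hg : 0 < g) (rt : Fin M → ℂ) :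
    ∫ r, vgauss M (g ^ 2) r * mgauss M S (rt - r) = mgauss M ((g : ℂ) ^ 2 • 1 + S) rt := by
  have hA := hS.inv.smul_one_add (inv_pos.2 (pow_pos hg 2))
  have hG := (hS.smul_one_add (pow_pos hg 2)).det_re_pos
  push_cast at hG
  have hdS := hS.det_re_pos
  have hpi := Real.pi_pos
  simp_rw [vgauss_mul_mgauss hS hg rfl]
  rw [integral_const_mul, 
    integral_sub_right_eq_self (fun r : Fin M → ℂ => Real.exp
      (-(star r ⬝ᵥ (((((g ^ 2)⁻¹ : ℝ) : ℂ) • 1 + S⁻¹) *ᵥ r)).re)),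
    integral_exp_neg_quadratic hA, det_re_precision hS hg, mgauss, shrinkage_mulVec_eq hS hg,
    dotProduct_smul, Complex.real_smul, Complex.re_ofReal_mul,
    inv_mul_cancel_left₀ (pow_pos hg 2).ne', mul_pow]
  field_simp

lemma integral_vgauss_mul_mgauss_smul (hS : S.PosDef) (hg : 0 < g) (rt : Fin M → ℂ) :
    ∫ r, (vgauss M (g ^ 2) r * mgauss M S (rt - r)) • r =
      mgauss M ((g : ℂ) ^ 2 • 1 + S) rt • ((((g : ℂ) ^ 2)⁻¹ • S + 1)⁻¹ *ᵥ rt) := by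
  have hA := hS.inv.smul_one_add (inv_pos.2 (pow_pos hg 2))
  rw [← integral_vgauss_mul_mgauss hS hg]
  simp_rw [vgauss_mul_mgauss hS hg rfl]
  rw [integral_const_mul, mul_smul, ← integral_exp_neg_quadratic_sub_smul hA, ← integral_smul]
  simp_rw [mul_smul]

end Posterior

open Matrix in
/-- the Bayes posterior mean for the prior `(1-λ)δ₀ + λ φ_{g²}^{(M)}` under
complex Gaussian noise of covariance `Σ`. -/
theorem stmt9
    (M : ℕ) (hM : 1 ≤ M)
    (S : Matrix (Fin M) (Fin M) ℂ) (hS : S.PosDef)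
    (g lam : ℝ) (hg : 0 < g) (hlam : lam ∈ Set.Ioo (0 : ℝ) 1)
    (rt : Fin M → ℂ)
    (D : ℝ)
    (hD : D = (1 - lam) * mgauss M S rt +
      lam * ∫ r : Fin M → ℂ, vgauss M (g ^ 2) r * mgauss M S (rt - r)) :
    0 < D ∧
      D⁻¹ • (lam • ∫ r : Fin M → ℂ, (vgauss M (g ^ 2) r * mgauss M S (rt - r)) • r) =
        (1 + (1 - lam) / lam * ((((g : ℂ) ^ 2 • (1 : Matrix (Fin M) (Fin M) ℂ) + S).det.re) / S.det.re)
            * Real.exp (-((star rt) ⬝ᵥ ((S⁻¹ - (S + (g : ℂ) ^ 2 • 1)⁻¹) *ᵥ rt)).re))⁻¹ •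
          ((((g : ℂ) ^ 2)⁻¹ • S + 1)⁻¹ *ᵥ rt) := by
  have hG := hS.smul_one_add (pow_pos hg 2)
  push_cast at hG
  have hdS := hS.det_re_pos
  have hdG := hG.det_re_pos
  have hmS := mgauss_pos hS rt
  have hmG := mgauss_pos hG rt
  obtain ⟨h0, h1⟩ := hlam
  have h1' : 0 < 1 - lam := sub_pos.2 h1
  rw [integral_vgauss_mul_mgauss hS hg] at hD
  have hDpos : 0 < D := by rw [hD]; positivity
  refine ⟨hDpos, ?_⟩
  rw [integral_vgauss_mul_mgauss_smul hS hg, smul_smul, smul_smul]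
  congr 1
  have hratio : mgauss M S rt = mgauss M ((g : ℂ) ^ 2 • 1 + S) rt *
      ((((g : ℂ) ^ 2 • (1 : Matrix (Fin M) (Fin M) ℂ) + S).det.re) / S.det.re *
        Real.exp (-((star rt) ⬝ᵥ ((S⁻¹ - (S + (g : ℂ) ^ 2 • 1)⁻¹) *ᵥ rt)).re)) := by
    have hpi := Real.pi_pos
    rw [add_comm S, sub_mulVec, dotProduct_sub, Complex.sub_re, neg_sub, sub_eq_add_neg,
      Real.exp_add, mgauss, mgauss,
      Real.exp_neg (star rt ⬝ᵥ (((g : ℂ) ^ 2 • 1 + S)⁻¹ *ᵥ rt)).re]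
    field_simp
  rw [hratio] at hD
  rw [hD] at hDpos ⊢
  rw [mul_assoc (_ / _) (_ / _)]
  have hc : 0 < ((g : ℂ) ^ 2 • (1 : Matrix (Fin M) (Fin M) ℂ) + S).det.re / S.det.re *
        Real.exp (-((star rt) ⬝ᵥ ((S⁻¹ - (S + (g : ℂ) ^ 2 • 1)⁻¹) *ᵥ rt)).re) := by
    positivity
  generalize _ / S.det.re * Real.exp _ = c at *
  field_simp
  ring
end
end
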